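/- arXiv:1909.10441 — 2 statements merged into one kernel-verified Lean document; each statement's English description precedes it below -/
import Mathlib

section
/- Let G be a simple graph that is acyclic (contains no cycles), in which every vertex has degree at most N, and let ρ be a vertex of G. Then for every integer m ≥ 0 the number of closed walks of length 2m in G starting and ending at ρ is at most C(2m, m) · N^m, where C(2m, m) is the central binomial coefficient. -/
/-- In an acyclic graph a vertex has at most one neighbour closer to `ρ`. -/
theorem toward_unique {V : Type*} (G : SimpleGraph V) (hG : G.IsAcyclic) {u w w' ρ : V}
    (hr : G.Reachable u ρ) (h : G.Adj u w) (h' : G.Adj u w')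
    (hd : G.dist u ρ = G.dist w ρ + 1) (hd' : G.dist u ρ = G.dist w' ρ + 1) : w = w' := by
  obtain ⟨q, hq⟩ := (h.symm.reachable.trans hr).exists_walk_length_eq_dist
  obtain ⟨q', hq'⟩ := (h'.symm.reachable.trans hr).exists_walk_length_eq_dist
  have p1 : (SimpleGraph.Walk.cons h q).IsPath :=
    SimpleGraph.Walk.isPath_of_length_eq_dist _ (by simp [hq, hd])
  have p2 : (SimpleGraph.Walk.cons h' q').IsPath :=
    SimpleGraph.Walk.isPath_of_length_eq_dist _ (by simp [hq', hd'])
  have e := Subtype.mk.inj ((hG.subsingleton_path u ρ).elim ⟨_, p1⟩ ⟨_, p2⟩)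
  have := congrArg SimpleGraph.Walk.snd e
  simpa using this

/-- Walks from `u` to `ρ` with `a` steps away from `ρ`. -/
theorem walks_bound {V : Type*} [DecidableEq V] (G : SimpleGraph V) [G.LocallyFinite]
    (hG : G.IsAcyclic) (N : ℕ) (hdeg : ∀ v, G.degree v ≤ N) (ρ : V) (n : ℕ) :
    ∀ (a : ℕ) (u : V), G.Reachable u ρ → n = 2 * a + G.dist u ρ →
    (G.finsetWalkLength n u ρ).card ≤ n.choose a * N ^ a := by
  induction n with
  | zero =>
    intro a u hr hn
    have ha : a = 0 := by omega
    subst ha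
    have hu : u = ρ := hr.dist_eq_zero_iff.mp (by omega)
    subst hu
    simp [SimpleGraph.finsetWalkLength]
  | succ n ih =>
    intro a u hr hn
    have h1 : (G.finsetWalkLength (n + 1) u ρ).card ≤
        ∑ w : G.neighborSet u, (G.finsetWalkLength n w ρ).card := by
      rw [SimpleGraph.finsetWalkLength]
      refine Finset.card_biUnion_le.trans ?_
      simp
    refine h1.trans ?_
    -- the contribution of a step away
    obtain ⟨B, hB, hBN⟩ : ∃ B : ℕ, (∀ w : G.neighborSet u, G.dist w ρ = G.dist u ρ + 1 →
        (G.finsetWalkLength n w ρ).card ≤ B) ∧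
        n.choose a * N ^ a + N * B = (n + 1).choose a * N ^ a := by
      cases a with
      | zero =>
        refine ⟨0, fun w hw => ?_, by simp⟩
        rw [Nat.le_zero, Finset.card_eq_zero, Finset.eq_empty_iff_forall_notMem]
        intro p hp
        have := SimpleGraph.mem_finsetWalkLength_iff.mp hp
        have := SimpleGraph.dist_le p
        omega
      | succ b =>
        refine ⟨n.choose b * N ^ b, fun w hw => ?_, ?_⟩
        · exact ih b w ((SimpleGraph.Adj.reachable w.2).symm.trans hr) (by omega)
        · rw [Nat.choose_succ_succ]; ring
    have hstep : ∀ w : G.neighborSet u, (G.finsetWalkLength n w ρ).card ≤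
        (if G.dist u ρ = G.dist w ρ + 1 then n.choose a * N ^ a else 0) + B := by
      intro w
      have hadj : G.Adj u w := w.2
      have := hG.dist_eq_dist_add_one_of_adj_of_reachable ρ hadj hr.symm
      rw [SimpleGraph.dist_comm (v := u), SimpleGraph.dist_comm (v := (w : V))] at this
      rcases this with h | h
      · rw [if_pos h]
        exact (ih a w (hadj.symm.reachable.trans hr) (by omega)).trans (Nat.le_add_right _ _)
      · exact (hB w h).trans (Nat.le_add_left _ _)
    refine (Finset.sum_le_sum fun w _ => hstep w).trans ?_
    rw [Finset.sum_add_distrib, ← hBN, ← Finset.sum_filter, Finset.sum_const, Finset.sum_const,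
      Finset.card_univ, SimpleGraph.card_neighborSet_eq_degree, smul_eq_mul, smul_eq_mul]
    have hc : (Finset.univ.filter
        fun w : G.neighborSet u => G.dist u ρ = G.dist w ρ + 1).card ≤ 1 := by
      rw [Finset.card_le_one]
      intro x hx y hy
      simp only [Finset.mem_filter, Finset.mem_univ, true_and] at hx hy
      exact Subtype.ext (toward_unique G hG hr x.2 y.2 hx hy)
    exact Nat.add_le_add ((Nat.mul_le_mul_right _ hc).trans (by simp))
      (Nat.mul_le_mul_right _ (hdeg u))

/-- In an acyclic graph with maximum degree at most `N`, the number of closed walks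
of length `2m` at a vertex `ρ` is at most `C(2m, m) · N^m`. -/
theorem stmt5 {V : Type*} [DecidableEq V] (G : SimpleGraph V) [G.LocallyFinite]
    (hG : G.IsAcyclic) (N : ℕ) (hdeg : ∀ v, G.degree v ≤ N) (ρ : V) (m : ℕ) :
    (G.finsetWalkLength (2 * m) ρ ρ).card ≤ (2 * m).choose m * N ^ m := by
  exact walks_bound G hG N hdeg ρ (2 * m) m ρ (SimpleGraph.Reachable.refl ρ) (by simp)
end

section
/- Fix c > 0 and δ ∈ (0, 1/4). For each integer n ≥ 2 set λ = √(c·log n / n), L = (1−4δ)·λ·n, and θ = (1/(λ+1))·(λ − 1/(δλn)). Then for all sufficiently large n one has 0 < θ < λ/(1+λ), and L·(1/(1−θ) − 1) + (1−δ)·λ·n·((1−θ) − 1) + (λ(1−θ)/(λ − θ − θλ) − 1) ≤ 0. -/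
/-- The analytic core of the supermartingale lemma: for large `n`, with
`λ = √(c log n / n)`, `L = (1−4δ)λn` and `θ = (1/(λ+1))(λ − 1/(δλn))`, one has
`0 < θ < λ/(1+λ)` and
`L(1/(1−θ) − 1) + (1−δ)λn((1−θ) − 1) + (λ(1−θ)/(λ−θ−θλ) − 1) ≤ 0`. -/
theorem stmt16 (c δ : ℝ) (hc : 0 < c) (hδ0 : 0 < δ) (hδ1 : δ < 1/4) :
    ∃ N : ℕ, ∀ n : ℕ, N ≤ n →
      let lam := Real.sqrt (c * Real.log n / n)
      let L := (1 - 4*δ) * lam * n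
      let θ := (1 / (lam + 1)) * (lam - 1 / (δ * lam * n))
      0 < θ ∧ θ < lam / (1 + lam) ∧
        L * (1/(1-θ) - 1) + (1-δ) * lam * n * ((1-θ) - 1)
          + (lam * (1-θ) / (lam - θ - θ*lam) - 1) ≤ 0 := by
  have h1 : Filter.Tendsto (fun n : ℕ => c * Real.log n) Filter.atTop Filter.atTop :=
    (Real.tendsto_log_atTop.comp tendsto_natCast_atTop_atTop).const_mul_atTop hc
  have h2 : Filter.Tendsto (fun n : ℕ => c * (Real.log n / n)) Filter.atTop (nhds (c * 0)) :=
    ((Real.isLittleO_log_id_atTop.tendsto_div_nhds_zero).comp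
      tendsto_natCast_atTop_atTop).const_mul c
  rw [mul_zero] at h2
  obtain ⟨N, hN⟩ := Filter.eventually_atTop.1 ((h1.eventually_gt_atTop (1 / δ)).and
    ((h2.eventually_le_const (show (0:ℝ) < δ ^ 2 by positivity)).and
      (Filter.eventually_ge_atTop 1)))
  refine ⟨N, fun n hn => ?_⟩
  obtain ⟨ha, hb, hn1⟩ := hN n hn
  intro lam L θ
  have hn0 : (0:ℝ) < n := by exact_mod_cast hn1
  have hA : 0 < c * Real.log n := lt_trans (by positivity) ha
  have hlam0 : 0 < lam := Real.sqrt_pos.2 (by positivity)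
  have hsq : lam ^ 2 = c * Real.log n / n := Real.sq_sqrt (by positivity)
  have hlamδ : lam ≤ δ := by
    apply Real.sqrt_le_iff.2 ⟨hδ0.le, ?_⟩
    rwa [mul_div_assoc]
  have hA2 : 1 / δ < lam * (lam * n) := by
    have : lam * (lam * n) = c * Real.log n := by
      rw [← mul_assoc, ← pow_two, hsq]; field_simp
    rw [this]; exact ha
  have hm0 : 0 < lam * n := by positivity
  have hL : L = (1 - 4 * δ) * (lam * n) := by simp only [L]; ring
  have hθ : θ * (lam + 1) = lam - 1 / (δ * (lam * n)) := by
    simp only [θ]; field_simp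
  have hm : (1 - δ) * lam * n = (1 - δ) * (lam * n) := by ring
  rw [hL, hm]
  clear_value θ L lam
  generalize lam * (n:ℝ) = m at *
  have hinv : 0 < 1 / (δ * m) := by positivity
  have hlt : 1 / (δ * m) < lam := by
    rw [div_lt_iff₀ (by positivity)] at hA2 ⊢
    linarith
  have hθ0 : 0 < θ := by
    by_contra h
    nlinarith
  have hθ1 : θ < lam / (1 + lam) := by
    rw [lt_div_iff₀ (by positivity)]
    linarith
  refine ⟨hθ0, hθ1, ?_⟩
  have hθδ : θ ≤ δ := by nlinarith
  have hd : lam - θ - θ * lam = 1 / (δ * m) := by linarith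
  have hl : lam * (δ * m) = θ * (lam + 1) * (δ * m) + 1 := by
    rw [hθ]; field_simp; ring
  rw [hd, div_div_eq_mul_div, div_one]
  have h3 : 1 / (1 - θ) - 1 = θ * (1 / (1 - θ)) := by
    have : 1 - θ ≠ 0 := by linarith
    field_simp; ring
  have h4 : (1 - 4 * δ) * (1 / (1 - θ)) ≤ 1 - 3 * δ := by
    rw [mul_one_div, div_le_iff₀ (by linarith)]
    nlinarith
  have h5 : lam * (1 - θ) * (δ * m) = θ * (lam + 1) * (δ * m) * (1 - θ) + (1 - θ) := by
    linear_combination (1 - θ) * hl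
  rw [h3, h5]
  have h6 : (lam + 1) * (1 - θ) ≤ 2 := by nlinarith
  have hmθ : 0 < m * θ := by positivity
  have h7 := mul_le_mul_of_nonneg_left h4 hmθ.le
  have h8 := mul_le_mul_of_nonneg_left h6 (mul_pos hmθ hδ0).le
  linarith
end
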